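/- arXiv:1611.09096 — 2 statements merged into one kernel-verified Lean document; each statement's English description precedes it below -/
import Mathlib

section
/- Let P = {v_0, v_1, …, v_{n−1}} be a set of n ≥ 3 points in convex position in the plane, and let C be a 1-plane Hamiltonian cycle on P that contains a diagonal edge v_i v_j. If one of the two parts of P determined by v_i v_j has an odd number of points, then C contains at least one boundary edge both of whose endpoints lie in that part. -/
open Finset

noncomputable section

/-- The Euclidean plane. -/
abbrev Pt : Type := EuclideanSpace ℝ (Fin 2)

/-- Strict counterclockwise orientation of an ordered triple of points. -/
def Ccw (p q r : Pt) : Prop :=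
  0 < (q 0 - p 0) * (r 1 - p 1) - (q 1 - p 1) * (r 0 - p 0)

/-- `v` lists `n` points in convex position, labeled counterclockwise. -/
def ConvexCcw {n : ℕ} (v : Fin n → Pt) : Prop :=
  ∀ i j k : Fin n, i < j → j < k → Ccw (v i) (v j) (v k)

/-- The open straight-line segment drawn for an unordered pair of indices. -/
def seg {n : ℕ} (v : Fin n → Pt) (e : Sym2 (Fin n)) : Set Pt :=
  Sym2.lift ⟨fun a b => openSegment ℝ (v a) (v b),
    fun a b => openSegment_symm ℝ (v a) (v b)⟩ e

/-- Two drawn edges cross: they share no endpoint and their open segments meet. -/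
def EdgesCross {n : ℕ} (v : Fin n → Pt) (e f : Sym2 (Fin n)) : Prop :=
  (∀ a, a ∈ e → a ∉ f) ∧ (seg v e ∩ seg v f).Nonempty

/-- A set of drawn edges is 1-plane: each edge is crossed by at most one other edge. -/
def OnePlane {n : ℕ} (v : Fin n → Pt) (E : Set (Sym2 (Fin n))) : Prop :=
  ∀ e ∈ E, {f | f ∈ E ∧ EdgesCross v e f}.Subsingleton

/-- `σ` is a Hamiltonian cycle on all `n` vertices. -/
def IsHamCycle {n : ℕ} (σ : Equiv.Perm (Fin n)) : Prop :=
  σ.IsCycle ∧ σ.support = Finset.univ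

/-- The edge set of the Hamiltonian cycle `σ`. -/
def cycEdges {n : ℕ} (σ : Equiv.Perm (Fin n)) : Set (Sym2 (Fin n)) :=
  {e | ∃ i : Fin n, e = s(i, σ i)}

/-- `σ` is a 1-plane Hamiltonian cycle for the point placement `v`. -/
def IsOnePlaneHC {n : ℕ} (v : Fin n → Pt) (σ : Equiv.Perm (Fin n)) : Prop :=
  IsHamCycle σ ∧ OnePlane v (cycEdges σ)

/-- `k` lies on the counterclockwise arc from `j` to `i` (inclusive), indices mod `n`. -/
def InArc {n : ℕ} (j i k : Fin n) : Prop := (k - j).val ≤ (i - j).val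

/-- The chords `ab` and `cd` of a linearly ordered convex point set have interleaved endpoints. -/
def Interleave (a b c d : ℕ) : Prop :=
  (min a b < min c d ∧ min c d < max a b ∧ max a b < max c d) ∨
    (min c d < min a b ∧ min a b < max c d ∧ max c d < max a b)

/-- Among the first `L` steps of the walk `p`, each is interleaved with at most one other. -/
def OnePlaneWalk (L : ℕ) (p : ℕ → ℕ) : Prop :=
  ∀ e < L, ∀ f < L, ∀ g < L, Interleave (p e) (p (e + 1)) (p f) (p (f + 1)) →
    Interleave (p e) (p (e + 1)) (p g) (p (g + 1)) → f = g

lemma exists_step {P : ℕ → Prop} {s t : ℕ} (hst : s ≤ t) (hs : P s) (ht : ¬ P t) :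
    ∃ k, s ≤ k ∧ k < t ∧ P k ∧ ¬ P (k + 1) := by
  induction t, hst using Nat.le_induction with
  | base => exact absurd hs ht
  | succ t hst ih =>
    by_cases h : P t
    · exact ⟨t, hst, by omega, h, ht⟩
    · obtain ⟨k, h1, h2, h3⟩ := ih h
      exact ⟨k, h1, by omega, h3⟩

lemma Interleave.swap {a b c d : ℕ} (h : Interleave a b c d) : Interleave b a d c := by
  unfold Interleave at *; omega

lemma OnePlaneWalk.shift {L M s : ℕ} {p : ℕ → ℕ} (h : OnePlaneWalk L p) (hM : s + M ≤ L) :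
    OnePlaneWalk M (fun k => p (s + k)) := fun e he f hf g hg h1 h2 => by
  have := h (s + e) (by omega) (s + f) (by omega) (s + g) (by omega) h1 h2
  omega

lemma OnePlaneWalk.reverse {L M t : ℕ} {p : ℕ → ℕ} (h : OnePlaneWalk L p) (ht : t ≤ L)
    (hM : M ≤ t) : OnePlaneWalk M (fun k => p (t - k)) := fun e he f hf g hg h1 h2 => by
  have key : ∀ k < M, t - k = t - (k + 1) + 1 := fun k hk => by omega
  have := h (t - (e + 1)) (by omega) (t - (f + 1)) (by omega) (t - (g + 1)) (by omega)
    (by rw [← key e he, ← key f hf]; exact h1.swap)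
    (by rw [← key e he, ← key g hg]; exact h2.swap)
  omega

/-- An injective walk of `L + 1` vertices inside an interval of `L + 1` labels visits them all. -/
lemma exists_time {L lo : ℕ} {p : ℕ → ℕ} (hval : ∀ k ≤ L, lo ≤ p k ∧ p k ≤ lo + L)
    (hinj : ∀ k ≤ L, ∀ l ≤ L, p k = p l → k = l) {x : ℕ} (h1 : lo ≤ x) (h2 : x ≤ lo + L) :
    ∃ k ≤ L, p k = x := by
  have hs := Finset.surjOn_of_injOn_of_card_le (s := Finset.Icc 0 L)
    (t := Finset.Icc lo (lo + L)) p
    (fun k hk => by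
      have := hval k (by simpa using hk)
      simpa using this)
    (fun k hk l hl => hinj k (by simpa using hk) l (by simpa using hl)) (by simp; omega)
  obtain ⟨k, hk, hkx⟩ := hs (show x ∈ (Finset.Icc lo (lo + L) : Set ℕ) by simp [h1, h2])
  exact ⟨k, by simpa using hk, hkx⟩

/-- If exactly the times in `[s, t)` carry labels in `[lo, hi)`, both intervals have the same
length. -/
lemma length_eq {s t lo hi : ℕ} {p : ℕ → ℕ} (hval : ∀ k, s ≤ k → k < t → lo ≤ p k ∧ p k < hi)
    (hinj : ∀ k, s ≤ k → k < t → ∀ l, s ≤ l → l < t → p k = p l → k = l)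
    (hsurj : ∀ x, lo ≤ x → x < hi → ∃ k, s ≤ k ∧ k < t ∧ p k = x) : t - s = hi - lo := by
  rw [← Nat.card_Ico, ← Nat.card_Ico]
  refine Finset.card_bij (fun k _ => p k) ?_ ?_ ?_
  · intro k hk
    simp only [Finset.mem_Ico] at hk ⊢
    exact hval k hk.1 hk.2
  · intro k hk l hl
    simp only [Finset.mem_Ico] at hk hl
    exact hinj k hk.1 hk.2 l hl.1 hl.2
  · intro x hx
    simp only [Finset.mem_Ico] at hx
    obtain ⟨k, h1, h2, h3⟩ := hsurj x hx.1 hx.2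
    exact ⟨k, by simp [h1, h2], h3⟩

/-- If a predicate switches only at time `w` within `[s, t]`, it is constant before and after. -/
lemma const_of_unique_step {P : ℕ → Prop} {s t w : ℕ} (hsw : s ≤ w) (hwt : w < t)
    (hw : P w) (hw' : ¬ P (w + 1))
    (huniq : ∀ k, s ≤ k → k < t → (P k ↔ ¬ P (k + 1)) → k = w) :
    (∀ k, s ≤ k → k ≤ w → P k) ∧ ∀ k, w < k → k ≤ t → ¬ P k := by
  constructor
  · intro k hk hkw
    by_contra hP
    obtain ⟨l, h1, h2, h3, h4⟩ := exists_step (P := fun k => ¬ P k) hkw hP (not_not.2 hw)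
    have := huniq l (by omega) (by omega) (by tauto)
    omega
  · intro k hk hkt hP
    obtain ⟨l, h1, h2, h3, h4⟩ :=
      exists_step (P := fun k => ¬ P k) (show w + 1 ≤ k by omega) hw' (not_not.2 hP)
    have := huniq l (by omega) (by omega) (by tauto)
    omega

/-- A 1-plane walk from the first to the last of an even number of consecutive labels, visiting
each of them once, contains a step between consecutive labels. -/
lemma exists_short_step (L : ℕ) : ∀ (lo : ℕ) (p : ℕ → ℕ), Odd L →
    (∀ k ≤ L, lo ≤ p k ∧ p k ≤ lo + L) → (∀ k ≤ L, ∀ l ≤ L, p k = p l → k = l) →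
    p 0 = lo → p L = lo + L → OnePlaneWalk L p →
    ∃ k < L, p (k + 1) = p k + 1 ∨ p k = p (k + 1) + 1 := by
  induction L using Nat.strong_induction_on with
  | _ L ih =>
  intro lo p hL hval hinj h0 hlast hplane
  have hLpos : 0 < L := hL.pos
  obtain ⟨a, ha⟩ : ∃ a, p 1 = lo + a := ⟨p 1 - lo, by have := hval 1 (by omega); omega⟩
  have ha0 : a ≠ 0 := fun h => by have := hinj 1 (by omega) 0 (by omega) (by omega); omega
  by_cases ha1 : a = 1
  · exact ⟨0, hLpos, Or.inl (by rw [zero_add]; omega)⟩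
  have haL : a < L := by
    have := hval 1 (by omega)
    by_contra h
    have := hinj 1 (by omega) L le_rfl (by omega)
    omega
  have hne0 : ∀ k, 1 ≤ k → k ≤ L → lo < p k := fun k h1 h2 => by
    have := hval k h2
    have : p k ≠ lo := fun h => by have := hinj k h2 0 (by omega) (by omega); omega
    omega
  have hnea : ∀ k, 2 ≤ k → k ≤ L → p k ≠ lo + a := fun k h1 h2 h => by
    have := hinj k h2 1 (by omega) (by omega); omega
  -- the walk crosses its first edge exactly once
  obtain ⟨t₁, ht₁L, ht₁⟩ := exists_time hval hinj (x := lo + 1) (by omega) (by omega)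
  have ht₁2 : 2 ≤ t₁ := by
    by_contra h
    obtain rfl | rfl : t₁ = 0 ∨ t₁ = 1 := by omega
    all_goals omega
  obtain ⟨w, hw1, hwL, hw, hw'⟩ := exists_step (P := fun k => p k < lo + a) ht₁L
    (by omega) (by omega)
  have hcross : ∀ k, 2 ≤ k → k < L → (p k < lo + a ↔ ¬ p (k + 1) < lo + a) →
      Interleave (p 0) (p (0 + 1)) (p k) (p (k + 1)) := fun k h1 h2 h3 => by
    have := hne0 k (by omega) (by omega)
    have := hne0 (k + 1) (by omega) (by omega)
    have := hnea k (by omega) (by omega)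
    have := hnea (k + 1) (by omega) (by omega)
    rw [zero_add, h0, ha]
    unfold Interleave; omega
  have hw0 := hcross w (by omega) hwL (by tauto)
  obtain ⟨hleft, hright⟩ := const_of_unique_step (P := fun k => p k < lo + a) (s := 2) (t := L)
    (by omega) hwL hw hw' fun k h1 h2 h3 =>
      hplane 0 hLpos k h2 w hwL (hcross k h1 h2 h3) hw0
  have honly : ∀ k < L, Interleave (p w) (p (w + 1)) (p k) (p (k + 1)) → k = 0 := fun k hk h =>
    hplane w hwL k hk 0 hLpos h (by unfold Interleave at hw0 ⊢; omega)
  have hwa : w = a := by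
    have := length_eq (s := 2) (t := w + 1) (lo := lo + 1) (hi := lo + a) (p := p)
      (fun k h1 h2 => ⟨hne0 k (by omega) (by omega), hleft k h1 (by omega)⟩)
      (fun k h1 h2 l h3 h4 => hinj k (by omega) l (by omega))
      (fun x h1 h2 => by
        obtain ⟨k, hk, hkx⟩ := exists_time hval hinj (x := x) (by omega) (by omega)
        have : k ≠ 0 := by rintro rfl; omega
        have : k ≠ 1 := by rintro rfl; omega
        have : ¬ w < k := fun h => hright k h hk (by omega)
        exact ⟨k, by omega, by omega, hkx⟩)
    omega
  subst hwa
  have hpw1 : lo + w < p (w + 1) := by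
    have := hnea (w + 1) (by omega) (by omega)
    omega
  have hpw : p w = lo + 1 := by
    by_contra hne
    have := hne0 w (by omega) (by omega)
    have ht₁w : t₁ ≠ w := by rintro rfl; exact hne ht₁
    obtain ⟨k, h1, h2, h3, h4⟩ := exists_step (P := fun k => p w < p k) (s := 1) (t := t₁)
      (by omega) (by omega) (by omega)
    have hk1 : p k ≤ lo + w := by
      rcases Nat.eq_or_lt_of_le h1 with rfl | h
      · omega
      · exact (hleft k h (by omega)).le
    have : p (k + 1) ≠ p w := fun h => by
      have := hinj (k + 1) (by omega) w (by omega) h; omega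
    have := honly k (by omega) (by
      unfold Interleave; omega)
    omega
  have hpw1' : p (w + 1) = lo + (w + 1) := by
    by_contra hne
    obtain ⟨t₂, ht₂L, ht₂⟩ := exists_time hval hinj (x := lo + (w + 1)) (by omega) (by omega)
    have hwt₂ : w < t₂ := by
      by_contra h
      rcases Nat.lt_or_ge t₂ 2 with h' | h'
      · obtain rfl | rfl : t₂ = 0 ∨ t₂ = 1 := by omega
        all_goals omega
      · have := hleft t₂ h' (by omega)
        omega
    have ht₂w : t₂ ≠ w + 1 := by rintro rfl; exact hne ht₂
    have hlt : p (w + 1) < lo + L := by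
      have := hval (w + 1) (by omega)
      by_contra h
      have := hinj (w + 1) (by omega) L le_rfl (by omega)
      omega
    obtain ⟨k, h1, h2, h3, h4⟩ := exists_step (P := fun k => p k < p (w + 1)) ht₂L
      (by omega) (by omega)
    have : p (k + 1) ≠ p (w + 1) := fun h => by
      have := hinj (k + 1) (by omega) (w + 1) (by omega) h; omega
    have := hright k (by omega) (by omega)
    have := honly k (by omega) (by
      unfold Interleave; omega)
    omega
  rcases Nat.even_or_odd w with hev | hod
  · obtain ⟨k, hk, h⟩ := ih (w - 1) (by omega) (lo + 1) (fun k => p (w - k))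
      (by
        obtain ⟨c, rfl⟩ := hev
        exact ⟨c - 1, by omega⟩)
      (fun k hk => by
        refine ⟨hne0 _ (by omega) (by omega), ?_⟩
        rcases Nat.lt_or_ge (w - k) 2 with h | h
        · rw [show w - k = 1 by omega]; omega
        · have := hleft (w - k) h (by omega)
          omega)
      (fun k hk l hl h => by
        have := hinj _ (by omega) _ (by omega) h
        omega)
      (by simpa using hpw)
      (by rw [show w - (w - 1) = 1 by omega]; omega)
      (hplane.reverse (by omega) (by omega))
    refine ⟨w - (k + 1), by omega, ?_⟩
    rw [show w - (k + 1) + 1 = w - k by omega]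
    exact h.symm
  · obtain ⟨k, hk, h⟩ := ih (L - (w + 1)) (by omega) (lo + (w + 1)) (fun k => p (w + 1 + k))
      (by
        obtain ⟨c, rfl⟩ := hod
        obtain ⟨d, rfl⟩ := hL
        exact ⟨d - c - 1, by omega⟩)
      (fun k hk => by
        have h1 := hval (w + 1 + k) (by omega)
        have h2 := hright (w + 1 + k) (by omega) (by omega)
        have h3 := hnea (w + 1 + k) (by omega) (by omega)
        omega)
      (fun k hk l hl h => by
        have := hinj _ (by omega) _ (by omega) h
        omega)
      (by simpa using hpw1')
      (by rw [show w + 1 + (L - (w + 1)) = L by omega]; omega)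
      (hplane.shift (by omega))
    exact ⟨w + 1 + k, by omega, h⟩

/-- A 1-plane closed walk through `n` cyclically ordered labels which closes up along the diagonal
from `m` to `0`, with `m` even, contains a step between consecutive labels in `[0, m]`. -/
lemma exists_short_step_of_closed {n m : ℕ} {p : ℕ → ℕ} (hm : Even m) (hm2 : 2 ≤ m)
    (hmn : m + 2 ≤ n) (hval : ∀ k < n, p k < n) (hinj : ∀ k < n, ∀ l < n, p k = p l → k = l)
    (h0 : p 0 = 0) (hlast : p (n - 1) = m) (hn : p n = 0) (hplane : OnePlaneWalk n p) :
    ∃ k < n, p k ≤ m ∧ p (k + 1) ≤ m ∧ (p (k + 1) = p k + 1 ∨ p k = p (k + 1) + 1) := by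
  have hval' : ∀ k ≤ n - 1, 0 ≤ p k ∧ p k ≤ 0 + (n - 1) := fun k hk => by
    have := hval k (by omega); omega
  have hinj' : ∀ k ≤ n - 1, ∀ l ≤ n - 1, p k = p l → k = l := fun k hk l hl =>
    hinj k (by omega) l (by omega)
  have hpos : ∀ k, 1 ≤ k → k < n → 0 < p k := fun k h1 h2 => by
    have : p k ≠ 0 := fun h => by have := hinj k h2 0 (by omega) (by omega); omega
    omega
  have hnem : ∀ k, k ≤ n - 2 → p k ≠ m := fun k h1 h => by
    have := hinj k (by omega) (n - 1) (by omega) (by omega); omega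
  have hcross : ∀ k, 1 ≤ k → k < n - 2 → (p k < m ↔ ¬ p (k + 1) < m) →
      Interleave (p (n - 1)) (p (n - 1 + 1)) (p k) (p (k + 1)) := fun k h1 h2 h3 => by
    have := hpos k (by omega) (by omega)
    have := hpos (k + 1) (by omega) (by omega)
    have := hnem k (by omega)
    have := hnem (k + 1) (by omega)
    rw [show n - 1 + 1 = n by omega, hn, hlast]
    unfold Interleave; omega
  have huniq : ∀ w, 1 ≤ w → w < n - 2 → (p w < m ↔ ¬ p (w + 1) < m) →
      (∀ k, 1 ≤ k → k < n - 2 → (p k < m ↔ ¬ p (k + 1) < m) → k = w) ∧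
      ∀ k < n, Interleave (p w) (p (w + 1)) (p k) (p (k + 1)) → k = n - 1 := by
    intro w h1 h2 h3
    have hw := hcross w h1 h2 h3
    refine ⟨fun k h4 h5 h6 => hplane (n - 1) (by omega) k (by omega) w (by omega)
      (hcross k h4 h5 h6) hw, fun k hk h => hplane w (by omega) k hk (n - 1) (by omega) h ?_⟩
    unfold Interleave at hw ⊢; omega
  obtain ⟨t₁, ht₁n, ht₁⟩ := exists_time hval' hinj' (x := 1) (by omega) (by omega)
  obtain ⟨t₂, ht₂n, ht₂⟩ := exists_time hval' hinj' (x := n - 1) (by omega) (by omega)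
  have ne0 : ∀ k, p k ≠ 0 → k ≠ 0 := by rintro _ h rfl; exact h h0
  have nelast : ∀ k, p k ≠ m → k ≠ n - 1 := by rintro _ h rfl; exact h hlast
  have := ne0 t₁ (by omega)
  have := ne0 t₂ (by omega)
  have := nelast t₁ (by omega)
  have := nelast t₂ (by omega)
  have hsub : ∀ s c lo, s + c < n → (∀ k ≤ c, lo ≤ p (s + k) ∧ p (s + k) ≤ lo + c) →
      lo + c ≤ m → p s = lo → p (s + c) = lo + c → Odd c →
      ∃ k < n, p k ≤ m ∧ p (k + 1) ≤ m ∧ (p (k + 1) = p k + 1 ∨ p k = p (k + 1) + 1) := by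
    intro s c lo hsc hv hlom hs ht hc
    obtain ⟨k, hk, h⟩ := exists_short_step c lo (fun k => p (s + k)) hc hv
      (fun k hk l hl h => by have := hinj _ (by omega) _ (by omega) h; omega)
      hs ht (hplane.shift (by omega))
    have h1 := hv k hk.le
    have h2 := hv (k + 1) hk
    exact ⟨s + k, by omega, by omega, by rw [add_assoc]; omega, h⟩
  have hodd : Odd (m - 1) := by
    obtain ⟨c, rfl⟩ := hm
    exact ⟨c - 1, by omega⟩
  rcases Nat.lt_or_ge t₁ t₂ with hlt | hge
  · obtain ⟨w, hw1, hw2, hw, hw'⟩ := exists_step (P := fun k => p k < m) hlt.le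
      (by omega) (by omega)
    obtain ⟨hu, honly⟩ := huniq w (by omega) (by omega) (by tauto)
    obtain ⟨hleft, hright⟩ := const_of_unique_step (P := fun k => p k < m) (s := 1) (t := n - 2)
      (by omega) (by omega) hw hw' hu
    have hwm : w = m - 1 := by
      have := length_eq (s := 1) (t := w + 1) (lo := 1) (hi := m) (p := p)
        (fun k h1 h2 => ⟨hpos k h1 (by omega), hleft k h1 (by omega)⟩)
        (fun k h1 h2 l h3 h4 => hinj k (by omega) l (by omega))
        (fun x h1 h2 => by
          obtain ⟨k, hk, hkx⟩ := exists_time hval' hinj' (x := x) (by omega) (by omega)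
          have := ne0 k (by omega)
          have := nelast k (by omega)
          have : ¬ w < k := fun h => hright k h (by omega) (by omega)
          exact ⟨k, by omega, by omega, hkx⟩)
      omega
    have hpw : p w = m - 1 := by
      by_contra hne
      obtain ⟨t, htn, ht⟩ := exists_time hval' hinj' (x := m - 1) (by omega) (by omega)
      have := nelast t (by omega)
      have : ¬ w < t := fun h => hright t h (by omega) (by omega)
      have htw : t ≠ w := by rintro rfl; exact hne ht
      obtain ⟨k, h1, h2, h3, h4⟩ := exists_step (P := fun k => p k < p w) (Nat.zero_le t)
        (by have := hpos w (by omega) (by omega); omega) (by omega)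
      have : p (k + 1) ≠ p w := fun h => by
        have := hinj (k + 1) (by omega) w (by omega) h; omega
      have := hleft (k + 1) (by omega) (by omega)
      have := honly k (by omega) (by unfold Interleave; omega)
      omega
    refine hsub 0 (m - 1) 0 (by omega) (fun k hk => ?_) (by omega) h0
      (by rw [zero_add, ← hwm, hpw, hwm]) hodd
    rw [zero_add]
    rcases Nat.eq_zero_or_pos k with rfl | hk0
    · omega
    · have := hleft k hk0 (by omega)
      omega
  · have hlt : t₂ < t₁ := by
      rcases Nat.eq_or_lt_of_le hge with rfl | h
      · omega
      · exact h
    obtain ⟨w, hw1, hw2, hw, hw'⟩ := exists_step (P := fun k => ¬ p k < m) hlt.le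
      (by omega) (by omega)
    obtain ⟨hu, honly⟩ := huniq w (by omega) (by omega) (by tauto)
    obtain ⟨hleft, hright⟩ := const_of_unique_step (P := fun k => ¬ p k < m) (s := 1)
      (t := n - 2) (by omega) (by omega) hw hw' (fun k h1 h2 h3 => hu k h1 h2 (by tauto))
    simp only [not_not] at hw hw' hleft hright
    have hwm : n - 1 - (w + 1) = m - 1 := by
      refine length_eq (s := w + 1) (t := n - 1) (lo := 1) (hi := m) (p := p)
        (fun k h1 h2 => ⟨hpos k (by omega) (by omega), hright k (by omega) (by omega)⟩)
        (fun k h1 h2 l h3 h4 => hinj k (by omega) l (by omega))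
        (fun x h1 h2 => ?_)
      obtain ⟨k, hk, hkx⟩ := exists_time hval' hinj' (x := x) (by omega) (by omega)
      have := ne0 k (by omega)
      have := nelast k (by omega)
      have : ¬ k ≤ w := fun h => hleft k (by omega) h (by omega)
      exact ⟨k, by omega, by omega, hkx⟩
    have hpw : p (w + 1) = 1 := by
      by_contra hne
      have := hpos (w + 1) (by omega) (by omega)
      have hwt : w + 1 ≠ t₁ := by rintro h; exact hne (h ▸ ht₁)
      obtain ⟨k, h1, h2, h3, h4⟩ := exists_step (P := fun k => p k < p (w + 1)) (s := t₁)
        (t := n - 1) (by omega) (by omega) (by omega)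
      have : p (k + 1) ≠ p (w + 1) := fun h => by
        have := hinj (k + 1) (by omega) (w + 1) (by omega) h; omega
      have : p (k + 1) ≤ m := by
        rcases Nat.eq_or_lt_of_le (show k + 1 ≤ n - 1 by omega) with h | h
        · rw [h]; omega
        · exact (hright (k + 1) (by omega) (by omega)).le
      have := hnem w (by omega)
      have := honly k (by omega) (by unfold Interleave; omega)
      omega
    refine hsub (w + 1) (m - 1) 1 (by omega) (fun k hk => ?_) (by omega) hpw
      (by rw [show w + 1 + (m - 1) = n - 1 by omega]; omega) hodd
    refine ⟨hpos _ (by omega) (by omega), ?_⟩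
    rcases Nat.eq_or_lt_of_le hk with rfl | hk'
    · rw [show w + 1 + (m - 1) = n - 1 by omega]; omega
    · have := hright (w + 1 + k) (by omega) (by omega)
      omega

lemma Ccw.rotate {p q r : Pt} (h : Ccw p q r) : Ccw q r p := by
  unfold Ccw at *; linarith

/-- The diagonals of a convex quadrilateral meet. -/
lemma openSegment_inter_of_ccw {A B C D : Pt} (habc : Ccw A B C) (habd : Ccw A B D)
    (hacd : Ccw A C D) (hbcd : Ccw B C D) :
    (openSegment ℝ A C ∩ openSegment ℝ B D).Nonempty := by
  unfold Ccw at *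
  set δ := (B 0 - A 0) * (C 1 - A 1) - (B 1 - A 1) * (C 0 - A 0) with hδ
  set γ := (B 0 - A 0) * (D 1 - A 1) - (B 1 - A 1) * (D 0 - A 0) with hγ
  set β := (C 0 - A 0) * (D 1 - A 1) - (C 1 - A 1) * (D 0 - A 0) with hβ
  set α := (C 0 - B 0) * (D 1 - B 1) - (C 1 - B 1) * (D 0 - B 0) with hα
  have hS : α + γ = β + δ := by rw [hα, hβ, hγ, hδ]; ring
  have hpos : 0 < α + γ := by positivity
  refine ⟨(α / (α + γ)) • A + (γ / (α + γ)) • C,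
    ⟨_, _, by positivity, by positivity, by field_simp, rfl⟩,
    ⟨β / (α + γ), δ / (α + γ), by positivity, by positivity, by rw [← add_div, hS]; field_simp,
      ?_⟩⟩
  ext t
  simp only [PiLp.add_apply, PiLp.smul_apply, smul_eq_mul]
  field_simp
  fin_cases t <;> simp only [Fin.zero_eta, Fin.mk_one, hα, hβ, hγ, hδ] <;> ring

/-- The position of `k` counted counterclockwise from `j`. -/
def pos {n : ℕ} (j k : Fin n) : ℕ := (k - j).val

lemma pos_injective {n : ℕ} [NeZero n] (j : Fin n) : Function.Injective (pos j) := fun _ _ h =>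
  sub_left_injective (Fin.ext h)

lemma pos_eq {n : ℕ} (j k : Fin n) :
    (j.val ≤ k.val ∧ pos j k = k.val - j.val) ∨ (k.val < j.val ∧ pos j k + j.val = n + k.val) := by
  unfold pos
  rcases le_or_gt j k with h | h
  · exact Or.inl ⟨h, Fin.sub_val_of_le h⟩
  · refine Or.inr ⟨h, ?_⟩
    have := Fin.coe_sub_iff_lt.2 h
    omega

lemma ccw_of_pos_lt {n : ℕ} {v : Fin n → Pt} (hv : ConvexCcw v) {j a b c : Fin n}
    (hab : pos j a < pos j b) (hbc : pos j b < pos j c) : Ccw (v a) (v b) (v c) := by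
  have h : (a < b ∧ b < c) ∨ (b < c ∧ c < a) ∨ (c < a ∧ a < b) := by
    simp only [Fin.lt_def]
    have := pos_eq j a
    have := pos_eq j b
    have := pos_eq j c
    omega
  rcases h with h | h | h
  · exact hv _ _ _ h.1 h.2
  · exact (hv _ _ _ h.1 h.2).rotate.rotate
  · exact (hv _ _ _ h.1 h.2).rotate

lemma edgesCross_of_pos_lt {n : ℕ} {v : Fin n → Pt} (hv : ConvexCcw v) {j a b c d : Fin n}
    (hab : pos j a < pos j b) (hbc : pos j b < pos j c) (hcd : pos j c < pos j d) :
    EdgesCross v s(a, c) s(b, d) := by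
  constructor
  · intro x hx hx'
    rw [Sym2.mem_iff] at hx hx'
    rcases hx with rfl | rfl <;> rcases hx' with rfl | rfl <;> omega
  · exact openSegment_inter_of_ccw (ccw_of_pos_lt hv hab hbc)
      (ccw_of_pos_lt hv hab (hbc.trans hcd)) (ccw_of_pos_lt hv (hab.trans hbc) hcd)
      (ccw_of_pos_lt hv hbc hcd)

lemma EdgesCross.symm {n : ℕ} {v : Fin n → Pt} {e f : Sym2 (Fin n)} (h : EdgesCross v e f) :
    EdgesCross v f e :=
  ⟨fun a ha ha' => h.1 a ha' ha, by rw [Set.inter_comm]; exact h.2⟩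

lemma edgesCross_of_interleave {n : ℕ} {v : Fin n → Pt} (hv : ConvexCcw v) {j a b c d : Fin n}
    (h : Interleave (pos j a) (pos j b) (pos j c) (pos j d)) :
    EdgesCross v s(a, b) s(c, d) := by
  wlog hab : pos j a ≤ pos j b generalizing a b
  · rw [Sym2.eq_swap]
    exact this (by unfold Interleave at *; omega) (by omega)
  wlog hcd : pos j c ≤ pos j d generalizing c d
  · rw [Sym2.eq_swap (a := c)]
    exact this (by unfold Interleave at *; omega) (by omega)
  unfold Interleave at h
  rcases h with h | h
  · exact edgesCross_of_pos_lt (j := j) hv (by omega) (by omega) (by omega)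
  · exact (edgesCross_of_pos_lt (j := j) hv (by omega) (by omega) (by omega)).symm

lemma IsHamCycle.inv {n : ℕ} {σ : Equiv.Perm (Fin n)} (h : IsHamCycle σ) : IsHamCycle σ⁻¹ :=
  ⟨h.1.inv, by rw [Equiv.Perm.support_inv]; exact h.2⟩

lemma cycEdges_inv {n : ℕ} (σ : Equiv.Perm (Fin n)) : cycEdges σ⁻¹ = cycEdges σ := by
  ext e
  constructor
  · rintro ⟨i, rfl⟩
    exact ⟨σ⁻¹ i, by simp [Sym2.eq_swap]⟩
  · rintro ⟨i, rfl⟩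
    exact ⟨σ i, by simp [Sym2.eq_swap]⟩

lemma IsHamCycle.pow_apply_eq_iff {n : ℕ} {σ : Equiv.Perm (Fin n)} (h : IsHamCycle σ)
    (x : Fin n) {a b : ℕ} : (σ ^ a) x = (σ ^ b) x ↔ a ≡ b [MOD n] := by
  have hc : σ.IsCycleOn (Finset.univ : Finset (Fin n)) := by
    have := h.1.isCycleOn
    rwa [← h.2, Equiv.Perm.coe_support_eq_set_support]
  simpa using hc.pow_apply_eq_pow_apply (Finset.mem_univ x)

/-- The positions visited by a 1-plane Hamiltonian cycle form a 1-plane walk. -/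
lemma IsOnePlaneHC.onePlaneWalk {n : ℕ} {v : Fin n → Pt} (hn : 3 ≤ n) (hv : ConvexCcw v)
    {σ : Equiv.Perm (Fin n)} (hC : IsOnePlaneHC v σ) (j : Fin n) :
    OnePlaneWalk n (fun k => pos j ((σ ^ k) j)) := by
  intro e he f hf g hg h1 h2
  have hmem : ∀ k, s((σ ^ k) j, (σ ^ (k + 1)) j) ∈ cycEdges σ := fun k =>
    ⟨(σ ^ k) j, by rw [pow_succ', Equiv.Perm.mul_apply]⟩
  have heq := hC.2 _ (hmem e) ⟨hmem f, edgesCross_of_interleave hv h1⟩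
    ⟨hmem g, edgesCross_of_interleave hv h2⟩
  rw [Sym2.eq_iff, hC.1.pow_apply_eq_iff, hC.1.pow_apply_eq_iff, hC.1.pow_apply_eq_iff,
    hC.1.pow_apply_eq_iff] at heq
  rcases heq with ⟨h, -⟩ | ⟨h, h'⟩
  · exact Nat.ModEq.eq_of_lt_of_lt h hf hg
  · have h3 : f + 2 ≡ f + 0 [MOD n] := (h'.add_right 1).trans h.symm
    have := Nat.ModEq.eq_of_lt_of_lt (Nat.ModEq.add_left_cancel' f h3) (by omega) (by omega)
    omega

lemma pos_add_one {n : ℕ} [NeZero n] {j a b : Fin n} (h : pos j b = pos j a + 1) :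
    b = a + 1 := by
  refine pos_injective j ?_
  rw [h]
  unfold pos at *
  have hb := (b - j).isLt
  rw [show a + 1 - j = (a - j) + 1 by abel, Fin.val_add_one_of_lt' (by omega)]

/-- if a 1-plane Hamiltonian cycle on `n ≥ 3` points in convex
position contains a diagonal edge `v_i v_j` and the part `{v_j, …, v_i}` of `P`
determined by it has an odd number of points, then the cycle contains a boundary
edge with both endpoints in that part. -/
theorem stmt0 {n : ℕ} [NeZero n] (hn : 3 ≤ n) (v : Fin n → Pt)
    (hconv : ConvexCcw v) (σ : Equiv.Perm (Fin n)) (hC : IsOnePlaneHC v σ)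
    (i j : Fin n) (hij : i ≠ j) (hdiag₁ : j ≠ i + 1) (hdiag₂ : i ≠ j + 1)
    (hedge : s(i, j) ∈ cycEdges σ)
    (hodd : Odd ((i - j).val + 1)) :
    ∃ k : Fin n, InArc j i k ∧ InArc j i (k + 1) ∧ s(k, k + 1) ∈ cycEdges σ := by
  wlog hσ : σ i = j generalizing σ
  · rw [← cycEdges_inv]
    refine this σ⁻¹ ⟨hC.1.inv, by rw [cycEdges_inv]; exact hC.2⟩ (by rwa [cycEdges_inv]) ?_
    obtain ⟨x, hx⟩ := hedge
    rw [Sym2.eq_iff] at hx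
    rcases hx with ⟨rfl, h⟩ | ⟨h, rfl⟩
    · exact absurd h.symm hσ
    · rw [h]; simp
  have hHam := hC.1
  set p : ℕ → ℕ := fun k => pos j ((σ ^ k) j) with hp
  have hpn : (σ ^ n) j = j := by
    have := (hHam.pow_apply_eq_iff j (a := n) (b := 0)).2 (by simp [Nat.ModEq])
    simpa using this
  have hlast : (σ ^ (n - 1)) j = i := by
    apply σ.injective
    rw [hσ, ← Equiv.Perm.mul_apply, ← pow_succ', show n - 1 + 1 = n by omega, hpn]
  have hjj : pos j j = 0 := by simp [pos]
  have hi0 : pos j i ≠ 0 := fun h => hij (pos_injective j (h.trans hjj.symm))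
  have hi1 : pos j i ≠ 1 := fun h => hdiag₂ (pos_add_one (j := j) (by omega))
  have hin : pos j i < n := (i - j).isLt
  have hin' : pos j i ≠ n - 1 := fun h => hdiag₁ (by
    have hlt : (i - j).val = n - 1 := h
    have : i - j + 1 = 0 := by
      apply Fin.ext
      rw [Fin.val_add, hlt, Fin.val_one', Nat.mod_eq_of_lt (show 1 < n by omega),
        show n - 1 + 1 = n by omega]
      simp
    rw [show j = j + (i - j + 1) by rw [this, add_zero]]
    abel)
  have hev : Even (pos j i) := by
    rw [Nat.odd_add_one, Nat.not_odd_iff_even] at hodd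
    exact hodd
  obtain ⟨k, -, h1, h2, h3⟩ := exists_short_step_of_closed (p := p) hev (by omega)
    (show pos j i + 2 ≤ n by omega) (fun k _ => Fin.isLt _)
    (fun k hk l hl h => Nat.ModEq.eq_of_lt_of_lt
      ((hHam.pow_apply_eq_iff j).1 (pos_injective j h)) hk hl)
    (by simpa [hp] using hjj) (by simp only [hp, hlast]) (by simp only [hp, hpn, hjj])
    (hC.onePlaneWalk hn hconv j)
  have hmem : s((σ ^ k) j, (σ ^ (k + 1)) j) ∈ cycEdges σ :=
    ⟨(σ ^ k) j, by rw [pow_succ', Equiv.Perm.mul_apply]⟩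
  rcases h3 with h3 | h3
  · rw [pos_add_one h3] at hmem
    exact ⟨_, h1, pos_add_one h3 ▸ h2, hmem⟩
  · rw [pos_add_one h3, Sym2.eq_swap] at hmem
    exact ⟨_, h2, pos_add_one h3 ▸ h1, hmem⟩

end
end

section
/- Let P = {v_0, v_1, …, v_{n−1}} be a set of n ≥ 3 points in convex position in the plane with n odd. Then every 1-plane Hamiltonian cycle on P contains at least three boundary edges. -/
open Finset

noncomputable section

/-- The diagonals of a convex quadrilateral meet. -/
lemma openSegment_inter_nonempty {a b c d : Pt} (habc : Ccw a b c) (habd : Ccw a b d)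
    (hacd : Ccw a c d) (hbcd : Ccw b c d) :
    (openSegment ℝ a c ∩ openSegment ℝ b d).Nonempty := by
  unfold Ccw at *
  set β := (b 0 - a 0) * (c 1 - a 1) - (b 1 - a 1) * (c 0 - a 0) with hβ
  set α := (b 0 - a 0) * (d 1 - a 1) - (b 1 - a 1) * (d 0 - a 0) with hα
  set δ := (c 0 - a 0) * (d 1 - a 1) - (c 1 - a 1) * (d 0 - a 0) with hδ
  set γ := (c 0 - b 0) * (d 1 - b 1) - (c 1 - b 1) * (d 0 - b 0) with hγ
  have hsum : β + δ = α + γ := by rw [hβ, hδ, hα, hγ]; ring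
  have hpos : 0 < α + γ := by positivity
  refine ⟨(γ / (α + γ)) • a + (α / (α + γ)) • c,
    ⟨_, _, by positivity, by positivity, by field_simp; ring, rfl⟩,
    ⟨δ / (α + γ), β / (α + γ), by positivity, by positivity, ?_, ?_⟩⟩
  · field_simp
    linarith
  · ext m
    simp only [PiLp.add_apply, PiLp.smul_apply, smul_eq_mul]
    field_simp
    rw [hβ, hδ, hα, hγ]
    fin_cases m <;> simp only [Fin.zero_eta, Fin.mk_one] <;> ring

lemma ConvexCcw.edgesCross_of_lt {n : ℕ} {v : Fin n → Pt} (hv : ConvexCcw v)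
    {a b c d : Fin n} (hab : a < b) (hbc : b < c) (hcd : c < d) :
    EdgesCross v s(a, c) s(b, d) := by
  constructor
  · intro x hx hx'
    simp only [Sym2.mem_iff] at hx hx'
    rcases hx with rfl | rfl <;> rcases hx' with rfl | rfl <;> order
  · exact openSegment_inter_nonempty (hv a b c hab hbc) (hv a b d hab (hbc.trans hcd))
      (hv a c d (hab.trans hbc) hcd) (hv b c d hbc hcd)

/-- Edges with interleaved endpoints cross. -/
lemma ConvexCcw.edgesCross {n : ℕ} {v : Fin n → Pt} (hv : ConvexCcw v)
    {i j x y : Fin n} (hix : i < x) (hxj : x < j) (hy : y < i ∨ j < y) :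
    EdgesCross v s(i, j) s(x, y) := by
  rcases hy with hy | hy
  · rw [Sym2.eq_swap (a := x)]
    exact (hv.edgesCross_of_lt hy hix hxj).symm
  · exact hv.edgesCross_of_lt hix hxj hy

lemma mk_mem_cycEdges {n : ℕ} {σ : Equiv.Perm (Fin n)} {x y : Fin n} :
    s(x, y) ∈ cycEdges σ ↔ σ x = y ∨ σ y = x := by
  constructor
  · rintro ⟨i, hi⟩
    rw [Sym2.eq_iff] at hi
    rcases hi with ⟨rfl, rfl⟩ | ⟨rfl, rfl⟩ <;> simp
  · rintro (rfl | rfl)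
    · exact ⟨x, rfl⟩
    · exact ⟨y, Sym2.eq_swap⟩

lemma val_add_one_cases {n : ℕ} [NeZero n] (hn : 2 ≤ n) (k : Fin n) :
    ((k + 1 : Fin n) : ℕ) = k + 1 ∨ (k : ℕ) = n - 1 ∧ ((k + 1 : Fin n) : ℕ) = 0 := by
  have h : ((k + 1 : Fin n) : ℕ) = (k + 1) % n := by
    rw [Fin.val_add, Fin.val_one', Nat.add_mod_mod]
  have hk := k.isLt
  rcases Nat.lt_or_ge (k + 1) n with h' | h'
  · left; rw [h, Nat.mod_eq_of_lt h']
  · right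
    have : (k : ℕ) + 1 = n := by omega
    rw [h, this]
    simp; omega

lemma IsHamCycle.exists_pow_apply_eq {n : ℕ} {σ : Equiv.Perm (Fin n)} (hσ : IsHamCycle σ)
    (x y : Fin n) : ∃ m : ℕ, (σ ^ m) x = y := by
  have h (z : Fin n) : σ z ≠ z := by
    rw [← Equiv.Perm.mem_support, hσ.2]; exact mem_univ z
  exact hσ.1.exists_pow_eq (h x) (h y)

lemma IsHamCycle.apply_ne {n : ℕ} {σ : Equiv.Perm (Fin n)} (hσ : IsHamCycle σ)
    (x : Fin n) : σ x ≠ x := by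
  rw [← Equiv.Perm.mem_support, hσ.2]; exact mem_univ x

/-- A nonempty proper subset of the vertices is left by the cycle. -/
lemma IsHamCycle.exists_exit {n : ℕ} {σ : Equiv.Perm (Fin n)} (hσ : IsHamCycle σ)
    (S : Set (Fin n)) {a p : Fin n} (ha : a ∈ S) (hp : p ∉ S) : ∃ x ∈ S, σ x ∉ S := by
  by_contra! h
  obtain ⟨m, rfl⟩ := hσ.exists_pow_apply_eq a p
  refine hp ?_
  clear hp
  induction m with
  | zero => exact ha
  | succ m ih =>
    rw [pow_succ', Equiv.Perm.mul_apply]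
    exact h _ ih

lemma IsHamCycle.apply_apply_ne {n : ℕ} (hn : 3 ≤ n) {σ : Equiv.Perm (Fin n)}
    (hσ : IsHamCycle σ) (x : Fin n) : σ (σ x) ≠ x := by
  intro h
  obtain ⟨p, hp⟩ : ∃ p : Fin n, p ∉ ({x, σ x} : Finset (Fin n)) := by
    by_contra! hall
    have h1 := card_le_card (fun p _ => hall p : (univ : Finset (Fin n)) ⊆ {x, σ x})
    have h2 := card_le_two (a := x) (b := σ x)
    rw [card_univ, Fintype.card_fin] at h1
    omega
  obtain ⟨y, hy, hy'⟩ := hσ.exists_exit ({x, σ x} : Set (Fin n)) (a := x) (by simp)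
    (p := p) (by simpa using hp)
  rcases hy with rfl | rfl
  · simp at hy'
  · simp [h] at hy'

/-- Every diagonal edge of a Hamiltonian cycle is interleaved with another edge. -/
lemma IsHamCycle.exists_interleaved {n : ℕ} {σ : Equiv.Perm (Fin n)} (hσ : IsHamCycle σ)
    {i j a b : Fin n} (hij : s(i, j) ∈ cycEdges σ) (hia : i < a) (haj : a < j)
    (hb : b < i ∨ j < b) :
    ∃ x y, i < x ∧ x < j ∧ (y < i ∨ j < y) ∧ s(x, y) ∈ cycEdges σ := by
  by_contra! hno
  have hno' (x : Fin n) (hix : i < x) (hxj : x < j) (y : Fin n) (hy : y < i ∨ j < y) :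
      σ x ≠ y ∧ σ y ≠ x := by
    have := hno x y hix hxj hy
    rwa [mk_mem_cycEdges, not_or] at this
  obtain ⟨p, q, hpq, hcase⟩ :
      ∃ p q : Fin n, σ p = q ∧ ((p = i ∧ q = j) ∨ (p = j ∧ q = i)) := by
    rw [mk_mem_cycEdges] at hij
    rcases hij with h | h
    · exact ⟨i, j, h, Or.inl ⟨rfl, rfl⟩⟩
    · exact ⟨j, i, h, Or.inr ⟨rfl, rfl⟩⟩
  have inj (x : Fin n) (hx : σ x = q) : x = p := σ.injective (hx.trans hpq.symm)
  have key (z : Fin n) (h : z ≠ p) (h' : z ≠ q) : (i < z ∧ z < j) ∨ (z < i ∨ j < z) := by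
    have : z ≠ i ∧ z ≠ j := by rcases hcase with ⟨rfl, rfl⟩ | ⟨rfl, rfl⟩ <;> tauto
    omega
  obtain ⟨x, hx, hx'⟩ := hσ.exists_exit {z | i < z ∧ z < j} ⟨hia, haj⟩ (p := p)
    (by simp only [Set.mem_ofPred_eq]; omega)
  obtain ⟨y, hy, hy'⟩ := hσ.exists_exit {z | z < i ∨ j < z} hb (p := p)
    (by simp only [Set.mem_ofPred_eq]; omega)
  simp only [Set.mem_ofPred_eq] at hx hx' hy hy'
  have hxp : σ x = p := by
    by_contra hne
    rcases key (σ x) hne (fun h => by have := inj x h; omega) with h | h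
    · exact hx' h
    · exact (hno' x hx.1 hx.2 _ h).1 rfl
  have hyp : σ y = p := by
    by_contra hne
    rcases key (σ y) hne (fun h => by have := inj y h; omega) with h | h
    · exact (hno' _ h.1 h.2 y hy).2 rfl
    · exact hy' h
  have : x = y := σ.injective (hxp.trans hyp.symm)
  omega

/-- Each edge of a 1-plane Hamiltonian cycle spans a boundary edge on its inner arc. -/
lemma IsOnePlaneHC.exists_boundary {n : ℕ} [NeZero n] (hn : 3 ≤ n)
    {v : Fin n → Pt} (hv : ConvexCcw v) {σ : Equiv.Perm (Fin n)} (hC : IsOnePlaneHC v σ)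
    {i j : Fin n} (hlt : i < j) (hij : s(i, j) ∈ cycEdges σ) :
    ∃ k, i ≤ k ∧ k < j ∧ s(k, k + 1) ∈ cycEdges σ := by
  induction hd : (j : ℕ) - i using Nat.strong_induction_on generalizing i j with
  | _ d ih =>
  have hjn := j.isLt
  have hm : ((i + 1 : Fin n) : ℕ) = i + 1 := by
    rcases val_add_one_cases (by omega) i with h | h <;> omega
  by_cases hj : j = i + 1
  · exact ⟨i, le_rfl, hlt, hj ▸ hij⟩
  have him : i < i + 1 := by omega
  have hmj : i + 1 < j := by omega
  obtain ⟨x, hx, hix, hxj⟩ : ∃ x, s(i + 1, x) ∈ cycEdges σ ∧ i ≤ x ∧ x ≤ j := by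
    by_contra! hno
    have h1 : s(i + 1, σ (i + 1)) ∈ cycEdges σ := mk_mem_cycEdges.2 (Or.inl rfl)
    have h2 : s(i + 1, σ.symm (i + 1)) ∈ cycEdges σ := mk_mem_cycEdges.2 (Or.inr (by simp))
    have outside (x : Fin n) (hx : s(i + 1, x) ∈ cycEdges σ) : x < i ∨ j < x := by
      by_contra! h
      exact absurd (hno x hx h.1) (not_lt.2 h.2)
    have heq := hC.2 _ hij ⟨h1, hv.edgesCross him hmj (outside _ h1)⟩
      ⟨h2, hv.edgesCross him hmj (outside _ h2)⟩
    rw [Sym2.congr_right] at heq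
    exact hC.1.apply_apply_ne hn (i + 1) (by rw [heq]; simp)
  have hxm : x ≠ i + 1 := by
    rintro rfl
    rw [mk_mem_cycEdges, or_self] at hx
    exact hC.1.apply_ne _ hx
  rcases eq_or_ne x i with rfl | hxi
  · exact ⟨x, le_rfl, hlt, by rwa [Sym2.eq_swap]⟩
  have hmx : i + 1 < x := by omega
  obtain ⟨k, hk, hkx, hmem⟩ := ih ((x : ℕ) - (i + 1 : Fin n)) (by omega) hmx hx rfl
  exact ⟨k, by omega, by omega, hmem⟩

/-- The boundary edges, as unordered pairs of indices. -/
def boundaryEdges (n : ℕ) [NeZero n] : Set (Sym2 (Fin n)) :=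
  Set.range fun k : Fin n => s(k, k + 1)

/-- Each diagonal edge of a Hamiltonian cycle is crossed by another diagonal edge. -/
lemma IsHamCycle.exists_edgesCross {n : ℕ} [NeZero n] (hn : 3 ≤ n)
    {v : Fin n → Pt} (hv : ConvexCcw v) {σ : Equiv.Perm (Fin n)} (hσ : IsHamCycle σ)
    {e : Sym2 (Fin n)} (he : e ∈ cycEdges σ \ boundaryEdges n) :
    ∃ f ∈ cycEdges σ \ boundaryEdges n, EdgesCross v e f := by
  obtain ⟨i, j, hlt, rfl⟩ : ∃ i j : Fin n, i < j ∧ e = s(i, j) := by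
    obtain ⟨i, rfl⟩ := he.1
    rcases lt_or_gt_of_ne (hσ.apply_ne i) with h | h
    · exact ⟨_, _, h, Sym2.eq_swap⟩
    · exact ⟨_, _, h, rfl⟩
  obtain ⟨he, hbd⟩ := he
  have hjn := j.isLt
  have hi := val_add_one_cases (by omega) i
  have hj := val_add_one_cases (by omega) j
  have hj1 : j ≠ i + 1 := by rintro rfl; exact hbd ⟨i, rfl⟩
  have hj2 : i ≠ j + 1 := by rintro rfl; exact hbd ⟨j, Sym2.eq_swap⟩
  obtain ⟨b, hb⟩ : ∃ b : Fin n, b < i ∨ j < b := by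
    rcases hj with h | h
    · exact ⟨j + 1, Or.inr (by omega)⟩
    · exact ⟨j + 1, Or.inl (by omega)⟩
  obtain ⟨x, y, hix, hxj, hy, hxy⟩ :=
    hσ.exists_interleaved he (a := i + 1) (by omega) (by omega) hb
  refine ⟨_, ⟨hxy, ?_⟩, hv.edgesCross hix hxj hy⟩
  rintro ⟨k, hk⟩
  have hk' := val_add_one_cases (by omega) k
  rw [Sym2.eq_iff] at hk
  rcases hk with ⟨h1, h2⟩ | ⟨h1, h2⟩ <;>
  · have h1 := congrArg Fin.val h1
    have h2 := congrArg Fin.val h2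
    omega

open Classical in
/-- The diagonal edges of a 1-plane Hamiltonian cycle are paired by crossing. -/
lemma IsOnePlaneHC.even_card_diagonal {n : ℕ} [NeZero n] (hn : 3 ≤ n)
    {v : Fin n → Pt} (hv : ConvexCcw v) {σ : Equiv.Perm (Fin n)} (hC : IsOnePlaneHC v σ) :
    Even #{e | e ∈ cycEdges σ \ boundaryEdges n} := by
  choose! g hg hcross using
    fun (e : Sym2 (Fin n)) (he : e ∈ cycEdges σ \ boundaryEdges n) =>
      hC.1.exists_edgesCross hn hv he
  have hsum : ∑ e : Sym2 (Fin n) with e ∈ cycEdges σ \ boundaryEdges n, (1 : ZMod 2) = 0 := by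
    refine sum_involution (fun e _ => g e) (fun _ _ => by decide) ?_ ?_ ?_
    · intro e he _ heq
      have h := (hcross e (mem_filter.1 he).2).1
      rw [heq] at h
      induction e with
      | _ a b => exact h a (Sym2.mem_mk_left a b) (Sym2.mem_mk_left a b)
    · intro e he
      exact mem_filter.2 ⟨mem_univ _, hg e (mem_filter.1 he).2⟩
    · intro e he
      have he := (mem_filter.1 he).2
      exact hC.2 _ (hg e he).1 ⟨(hg _ (hg e he)).1, hcross _ (hg e he)⟩
        ⟨he.1, (hcross e he).symm⟩
  rw [sum_const, nsmul_one, ZMod.natCast_eq_zero_iff_even] at hsum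
  exact hsum

open Classical in
lemma IsOnePlaneHC.odd_card_boundary {n : ℕ} [NeZero n] (hn : 3 ≤ n) (hodd : Odd n)
    {v : Fin n → Pt} (hv : ConvexCcw v) {σ : Equiv.Perm (Fin n)} (hC : IsOnePlaneHC v σ) :
    Odd #{k : Fin n | s(k, k + 1) ∈ cycEdges σ} := by
  have hE : #{e | e ∈ cycEdges σ} = n := by
    have : ({e | e ∈ cycEdges σ} : Finset (Sym2 (Fin n))) =
        univ.image fun i => s(i, σ i) := by
      ext e
      simp only [mem_filter, mem_univ, true_and, mem_image]
      exact exists_congr fun _ => eq_comm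
    rw [this, card_image_of_injective, card_univ, Fintype.card_fin]
    intro i j hij
    rw [Sym2.eq_iff] at hij
    rcases hij with h | ⟨h1, h2⟩
    · exact h.1
    · subst h1
      exact absurd h2 (hC.1.apply_apply_ne hn j)
  have hB : #{k : Fin n | s(k, k + 1) ∈ cycEdges σ} =
      #{e | e ∈ cycEdges σ ∩ boundaryEdges n} := by
    have : ({e | e ∈ cycEdges σ ∩ boundaryEdges n} : Finset (Sym2 (Fin n))) =
        ({k | s(k, k + 1) ∈ cycEdges σ} : Finset (Fin n)).image fun k => s(k, k + 1) := by
      ext e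
      simp only [mem_filter, mem_univ, true_and, mem_image, boundaryEdges, Set.mem_inter_iff,
        Set.mem_range]
      constructor
      · rintro ⟨h, k, rfl⟩
        exact ⟨k, h, rfl⟩
      · rintro ⟨k, h, rfl⟩
        exact ⟨h, k, rfl⟩
    rw [this, card_image_of_injective]
    intro k l hkl
    have hk := val_add_one_cases (by omega) k
    have hl := val_add_one_cases (by omega) l
    rw [Sym2.eq_iff] at hkl
    rcases hkl with h | ⟨h1, h2⟩
    · exact h.1
    · have h1 := congrArg Fin.val h1
      have h2 := congrArg Fin.val h2
      omega
  have hsplit := card_filter_add_card_filter_not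
    (s := ({e | e ∈ cycEdges σ} : Finset (Sym2 (Fin n)))) (· ∈ boundaryEdges n)
  rw [filter_filter, filter_filter] at hsplit
  have heven := hC.even_card_diagonal hn hv
  simp only [Set.mem_sdiff] at heven
  simp only [Set.mem_inter_iff] at hB
  rw [← hB, hE] at hsplit
  rw [← hsplit, Nat.odd_add] at hodd
  tauto

/-- every 1-plane Hamiltonian cycle on `n ≥ 3` points in convex
position, with `n` odd, contains at least three boundary edges. -/
theorem stmt3 {n : ℕ} [NeZero n] (hn : 3 ≤ n) (hodd : Odd n)
    (v : Fin n → Pt) (hconv : ConvexCcw v)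
    (σ : Equiv.Perm (Fin n)) (hC : IsOnePlaneHC v σ) :
    ∃ k l m : Fin n, k ≠ l ∧ k ≠ m ∧ l ≠ m ∧
      s(k, k + 1) ∈ cycEdges σ ∧ s(l, l + 1) ∈ cycEdges σ ∧
      s(m, m + 1) ∈ cycEdges σ := by
  classical
  have hodd' := hC.odd_card_boundary hn hodd hconv
  suffices h : 1 < #{k : Fin n | s(k, k + 1) ∈ cycEdges σ} by
    obtain ⟨k, l, m, hk, hl, hm, hkl, hkm, hlm⟩ := two_lt_card_iff.1
      (show 2 < #{k : Fin n | s(k, k + 1) ∈ cycEdges σ} by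
        rcases hodd' with ⟨r, hr⟩; omega)
    simp only [mem_filter, mem_univ, true_and] at hk hl hm
    exact ⟨k, l, m, hkl, hkm, hlm, hk, hl, hm⟩
  by_contra h
  obtain ⟨k, hk⟩ := card_pos.1 hodd'.pos
  have huniq (l : Fin n) (hl : s(l, l + 1) ∈ cycEdges σ) : l = k :=
    card_le_one.1 (not_lt.1 h) l (by simpa using hl) k hk
  have hcut (i j : Fin n) (hlt : i < j) (hij : s(i, j) ∈ cycEdges σ) : i ≤ k ∧ k < j := by
    obtain ⟨l, h1, h2, h3⟩ := hC.exists_boundary hn hconv hlt hij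
    obtain rfl := huniq l h3
    exact ⟨h1, h2⟩
  have hswap (i : Fin n) : σ i ≤ k ↔ ¬ i ≤ k := by
    rcases lt_or_gt_of_ne (hC.1.apply_ne i) with h | h
    · have := hcut _ _ h (mk_mem_cycEdges.2 (Or.inr rfl))
      omega
    · have := hcut _ _ h (mk_mem_cycEdges.2 (Or.inl rfl))
      omega
  have hcard : #{i : Fin n | i ≤ k} = #{i : Fin n | ¬ i ≤ k} :=
    (card_bijective σ σ.bijective fun i => by simp only [mem_filter, mem_univ, true_and, hswap]).symm
  have hsplit := card_filter_add_card_filter_not (s := (univ : Finset (Fin n))) (· ≤ k)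
  rw [card_univ, Fintype.card_fin, hcard] at hsplit
  rcases hodd with ⟨r, hr⟩
  omega

end
end
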